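/- arXiv:2207.08094 — 3 statements merged into one kernel-verified Lean document; each statement's English description precedes it below -/
import Mathlib

section
/- Let K be a field, V and W vector spaces over K, T : V → W a linear map, and v : ι → V a family of vectors. Then the matroid M(T∘v) of the image family is a quotient of the matroid M(v): every flat of M(T∘v) is a flat of M(v). -/
/-- `F ⊆ ι` is a flat of the matroid `M(v)` of the vector configuration `v : ι → V`
(whose independent sets are the linearly independent subfamilies): `F` contains every
index `i` with `v i` in the span of `{v_j : j ∈ F}`. -/
def IsConfigFlat (K : Type*) {V ι : Type*} [Field K] [AddCommGroup V] [Module K V]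
    (v : ι → V) (F : Set ι) : Prop :=
  ∀ i : ι, v i ∈ Submodule.span K (v '' F) → i ∈ F

/-- For a linear map `T : V → W` and a vector configuration `v : ι → V`, the matroid
`M(T∘v)` is a quotient of `M(v)`: every flat of `M(T∘v)` is a flat of `M(v)`. -/
theorem configFlat_quotient {K V W ι : Type*} [Field K]
    [AddCommGroup V] [Module K V] [AddCommGroup W] [Module K W]
    (T : V →ₗ[K] W) (v : ι → V) :
    ∀ F : Set ι, IsConfigFlat K (T ∘ v) F → IsConfigFlat K v F := by
  intro F hF i hi
  refine hF i ?_
  rw [Set.image_comp, ← Submodule.map_span]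
  exact Submodule.mem_map_of_mem hi
end

section
/- Let K be a field, let E₁ and E₂ be disjoint finite index sets, and let F be an r-dimensional subspace of K^{E₁⊔E₂}. Suppose there exist families 𝔅₁ of subsets of E₁ and 𝔅₂ of subsets of E₂ such that the Plücker bases of F are exactly the sets of the form B₁ ∪ B₂ with B₁ ∈ 𝔅₁ and B₂ ∈ 𝔅₂. Then F decomposes as F = (F ∩ K^{E₁}) ⊕ (F ∩ K^{E₂}), where K^{E_i} denotes the coordinate subspace of vectors supported on E_i. (This is the point-level content of the isomorphism Gr(Q₁ ⊕ Q₂) ≅ Gr(Q₁) × Gr(Q₂) for direct sums of matroids.) -/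
/-- The coordinate subspace of `ι → K` consisting of the vectors supported on `E`. -/
def coordSubspace (K : Type*) [Field K] {ι : Type*} (E : Set ι) : Submodule K (ι → K) where
  carrier := {x | ∀ i ∉ E, x i = 0}
  add_mem' := by
    intro a b ha hb i hi
    simp [ha i hi, hb i hi]
  zero_mem' := by intro i _; rfl
  smul_mem' := by
    intro c x hx i hi
    simp [hx i hi]

/-- `λ` is a Plücker basis of the subspace `F ⊆ K^ι`: the restriction to `F` of the
coordinate projection `K^ι → K^λ` is a linear isomorphism (equivalently, the Plücker
coordinate `ζ_λ(F)` is nonzero). -/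
def IsPlueckerBasis {K ι : Type*} [Field K] (F : Submodule K (ι → K)) (l : Finset ι) : Prop :=
  Function.Bijective ((LinearMap.funLeft K K (Subtype.val : {i // i ∈ l} → ι)).comp F.subtype)

section PlueckerBasis

variable {K ι : Type*} [Field K] {F : Submodule K (ι → K)}

/-- A finite set `l` is a Plücker basis of `F` iff vectors of `F` are determined by their
coordinates in `l` and `F` contains a family dual to the coordinates in `l`. -/
theorem isPlueckerBasis_iff_exists_dual [DecidableEq ι] {l : Finset ι} :
    IsPlueckerBasis F l ↔ (∀ x ∈ F, (∀ i ∈ l, x i = 0) → x = 0) ∧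
      ∀ e ∈ l, ∃ x ∈ F, ∀ i ∈ l, x i = Pi.single (M := fun _ ↦ K) e 1 i := by
  refine and_congr ?_ ⟨fun h e _ ↦ ?_, fun h y ↦ ?_⟩
  · rw [← LinearMap.ker_eq_bot, LinearMap.ker_eq_bot']
    simp [funext_iff, LinearMap.funLeft_apply]
  · obtain ⟨x, hx⟩ := h fun i ↦ Pi.single (M := fun _ ↦ K) e 1 i.1
    exact ⟨x, x.2, fun i hi ↦ congr_fun hx ⟨i, hi⟩⟩
  · choose! f hf hfi using h
    refine ⟨∑ e : {i // i ∈ l}, y e • ⟨f e, hf e e.2⟩, funext fun i ↦ ?_⟩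
    simp [LinearMap.funLeft_apply, hfi _ (Subtype.prop _) _ i.2, Pi.single_apply]

theorem exists_isPlueckerBasis [Fintype ι] [DecidableEq ι] (F : Submodule K (ι → K)) :
    ∃ l : Finset ι, IsPlueckerBasis F l := by
  obtain ⟨l, hl⟩ := (Set.toFinite
    {l : Finset ι | ∀ x ∈ F, (∀ i ∈ l, x i = 0) → x = 0}).exists_minimal
    ⟨Finset.univ, fun x _ h ↦ funext fun i ↦ h i (Finset.mem_univ i)⟩
  refine ⟨l, isPlueckerBasis_iff_exists_dual.2 ⟨hl.prop, fun e he ↦ ?_⟩⟩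
  have hne := hl.not_prop_of_lt (Finset.erase_ssubset he)
  simp only [Set.mem_ofPred_eq, not_forall] at hne
  obtain ⟨x, hx, hx0, hxne⟩ := hne
  have hxe : x e ≠ 0 := fun h ↦ hxne <| hl.prop x hx fun i hi ↦ by
    by_cases hie : i = e
    · rwa [hie]
    · exact hx0 i (Finset.mem_erase.2 ⟨hie, hi⟩)
  refine ⟨(x e)⁻¹ • x, F.smul_mem _ hx, fun i hi ↦ ?_⟩
  by_cases hie : i = e
  · simp [hie, hxe]
  · simp [hie, hx0 i (Finset.mem_erase.2 ⟨hie, hi⟩)]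

/-- A Plücker basis does not properly contain another one. -/
theorem IsPlueckerBasis.not_insert [DecidableEq ι] {l : Finset ι} (h : IsPlueckerBasis F l)
    {j : ι} (hj : j ∉ l) : ¬ IsPlueckerBasis F (insert j l) := by
  intro h'
  obtain ⟨x, hx, hxi⟩ := (isPlueckerBasis_iff_exists_dual.1 h').2 j (Finset.mem_insert_self j l)
  have hx0 := (isPlueckerBasis_iff_exists_dual.1 h).1 x hx fun i hi ↦ by
    rw [hxi i (Finset.mem_insert_of_mem hi), Pi.single_eq_of_ne (ne_of_mem_of_not_mem hi hj)]
  simpa [hx0] using hxi j (Finset.mem_insert_self j l)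

/-- Basis exchange: `e ∈ l` may be replaced by any `j` at which the dual vector of `e` does not
vanish. -/
theorem IsPlueckerBasis.exchange [DecidableEq ι] {l : Finset ι} (h : IsPlueckerBasis F l)
    {e j : ι} (he : e ∈ l) {x : ι → K} (hx : x ∈ F)
    (hxi : ∀ i ∈ l, x i = Pi.single (M := fun _ ↦ K) e 1 i) (hj : j ∉ l) (hxj : x j ≠ 0) :
    IsPlueckerBasis F (insert j (l.erase e)) := by
  rw [isPlueckerBasis_iff_exists_dual] at h ⊢
  obtain ⟨hinj, hdual⟩ := h
  have hx0 : ∀ i ∈ l.erase e, x i = 0 := fun i hi ↦ by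
    rw [hxi i (Finset.mem_of_mem_erase hi), Pi.single_eq_of_ne (Finset.ne_of_mem_erase hi)]
  have hxe : x e = 1 := by rw [hxi e he, Pi.single_eq_same]
  simp only [Finset.forall_mem_insert]
  refine ⟨fun y hy ⟨hyj, hy0⟩ ↦ ?_, ?_, fun b hb ↦ ?_⟩
  · have hyx : y - y e • x = 0 := hinj _ (F.sub_mem hy (F.smul_mem _ hx)) fun i hi ↦ by
      by_cases hie : i = e
      · simp [hie, hxe]
      · have hi' := Finset.mem_erase.2 ⟨hie, hi⟩
        simp [hy0 i hi', hx0 i hi']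
    have hye : y e = 0 := by simpa [hyj, hxj] using congr_fun hyx j
    simpa [hye] using hyx
  · refine ⟨(x j)⁻¹ • x, F.smul_mem _ hx, by simp [hxj], fun i hi ↦ ?_⟩
    have hij : i ≠ j := ne_of_mem_of_not_mem (Finset.mem_of_mem_erase hi) hj
    simp [hx0 i hi, hij]
  · obtain ⟨y, hy, hyi⟩ := hdual b (Finset.mem_of_mem_erase hb)
    have hjb : j ≠ b := (ne_of_mem_of_not_mem (Finset.mem_of_mem_erase hb) hj).symm
    refine ⟨y - (y j / x j) • x, F.sub_mem hy (F.smul_mem _ hx), by simp [hxj, hjb],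
      fun i hi ↦ ?_⟩
    simp [hx0 i hi, hyi i (Finset.mem_of_mem_erase hi)]

/-- If the Plücker bases of `F` form a product family over `E₁ ⊔ E₂`, then the dual vector of a
basis element in `E₁` is supported on `E₁`. -/
theorem dual_mem_coordSubspace [DecidableEq ι] {E₁ E₂ : Set ι} (hdisj : Disjoint E₁ E₂)
    (hcover : E₁ ∪ E₂ = Set.univ) {𝔅₁ 𝔅₂ : Set (Finset ι)}
    (h𝔅₁ : ∀ b ∈ 𝔅₁, (b : Set ι) ⊆ E₁) (h𝔅₂ : ∀ b ∈ 𝔅₂, (b : Set ι) ⊆ E₂)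
    (hpl : ∀ l : Finset ι, IsPlueckerBasis F l ↔ ∃ b₁ ∈ 𝔅₁, ∃ b₂ ∈ 𝔅₂, l = b₁ ∪ b₂)
    {b₁ b₂ : Finset ι} (hb₁ : b₁ ∈ 𝔅₁) (hb₂ : b₂ ∈ 𝔅₂) {e : ι} (he : e ∈ b₁)
    {x : ι → K} (hx : x ∈ F)
    (hxi : ∀ i ∈ b₁ ∪ b₂, x i = Pi.single (M := fun _ ↦ K) e 1 i) :
    x ∈ coordSubspace K E₁ := by
  intro j hj₁
  have hj₂ : j ∈ E₂ := (hcover.symm ▸ Set.mem_univ j : j ∈ E₁ ∪ E₂).resolve_left hj₁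
  have hbasis : IsPlueckerBasis F (b₁ ∪ b₂) := (hpl _).2 ⟨b₁, hb₁, b₂, hb₂, rfl⟩
  have hje : j ≠ e := fun h ↦ hj₁ (h ▸ h𝔅₁ b₁ hb₁ he)
  by_cases hj : j ∈ b₁ ∪ b₂
  · rw [hxi j hj, Pi.single_eq_of_ne hje]
  by_contra hxj
  obtain ⟨c₁, hc₁, c₂, hc₂, hc⟩ :=
    (hpl _).1 (hbasis.exchange (Finset.mem_union_left _ he) hx hxi hj hxj)
  have hc₂' : c₂ = insert j b₂ := by
    ext i
    have hi := Finset.ext_iff.1 hc i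
    have h₁ : i ∈ b₁ → i ∈ E₁ := fun h ↦ h𝔅₁ b₁ hb₁ h
    have h₂ : i ∈ b₂ → i ∈ E₂ := fun h ↦ h𝔅₂ b₂ hb₂ h
    have h₃ : i ∈ c₁ → i ∈ E₁ := fun h ↦ h𝔅₁ c₁ hc₁ h
    have h₄ : i ∈ c₂ → i ∈ E₂ := fun h ↦ h𝔅₂ c₂ hc₂ h
    have h₅ : i ∈ E₁ → i ∉ E₂ := fun h h' ↦ Set.disjoint_left.1 hdisj h h'
    have h₆ : e ∈ E₁ := h𝔅₁ b₁ hb₁ he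
    simp only [Finset.mem_insert, Finset.mem_erase, Finset.mem_union] at hi ⊢
    grind
  refine hbasis.not_insert hj ((hpl _).2 ⟨b₁, hb₁, c₂, hc₂, ?_⟩)
  rw [hc₂', Finset.union_insert]

end PlueckerBasis

/-- If the Plücker bases of an `r`-dimensional subspace `F ⊆ K^{E₁⊔E₂}` are exactly the
unions `B₁ ∪ B₂` with `B₁ ∈ 𝔅₁` (subsets of `E₁`) and `B₂ ∈ 𝔅₂` (subsets of `E₂`), then
`F` decomposes as `F = (F ∩ K^{E₁}) ⊕ (F ∩ K^{E₂})`. -/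
theorem subspace_decomposition {K ι : Type*} [Field K] [Fintype ι] [DecidableEq ι]
    (E₁ E₂ : Set ι) (hdisj : Disjoint E₁ E₂) (hcover : E₁ ∪ E₂ = Set.univ)
    (r : ℕ) (F : Submodule K (ι → K)) (hF : Module.finrank K F = r)
    (𝔅₁ 𝔅₂ : Set (Finset ι))
    (h𝔅₁ : ∀ b ∈ 𝔅₁, (b : Set ι) ⊆ E₁) (h𝔅₂ : ∀ b ∈ 𝔅₂, (b : Set ι) ⊆ E₂)
    (hpl : ∀ l : Finset ι, IsPlueckerBasis F l ↔ ∃ b₁ ∈ 𝔅₁, ∃ b₂ ∈ 𝔅₂, l = b₁ ∪ b₂) :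
    F = (F ⊓ coordSubspace K E₁) ⊔ (F ⊓ coordSubspace K E₂) := by
  refine le_antisymm (fun x hx ↦ ?_) (sup_le inf_le_left inf_le_left)
  obtain ⟨l, hl⟩ := exists_isPlueckerBasis F
  obtain ⟨b₁, hb₁, b₂, hb₂, rfl⟩ := (hpl l).1 hl
  obtain ⟨hinj, hdual⟩ := isPlueckerBasis_iff_exists_dual.1 hl
  choose! f hf hfi using hdual
  have hsum : x = ∑ e ∈ b₁ ∪ b₂, x e • f e := by
    refine sub_eq_zero.1 (hinj _ (F.sub_mem hx (F.sum_mem fun e he ↦ F.smul_mem _ (hf e he)))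
      fun i hi ↦ ?_)
    have hterm : ∀ e ∈ b₁ ∪ b₂, x e * f e i = if i = e then x e else 0 := fun e he ↦ by
      simp [hfi e he i hi, Pi.single_apply]
    rw [Pi.sub_apply, Finset.sum_apply]
    simp only [Pi.smul_apply, smul_eq_mul]
    rw [Finset.sum_congr rfl hterm, Finset.sum_ite_eq, if_pos hi, sub_self]
  rw [hsum]
  refine Submodule.sum_mem _ fun e he ↦ Submodule.smul_mem _ _ ?_
  rcases Finset.mem_union.1 he with he' | he'
  · exact Submodule.mem_sup_left ⟨hf e he,
      dual_mem_coordSubspace hdisj hcover h𝔅₁ h𝔅₂ hpl hb₁ hb₂ he' (hf e he) (hfi e he)⟩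
  · have hpl' : ∀ l : Finset ι,
        IsPlueckerBasis F l ↔ ∃ b₂ ∈ 𝔅₂, ∃ b₁ ∈ 𝔅₁, l = b₂ ∪ b₁ := fun l ↦ by
      rw [hpl]
      constructor
      · rintro ⟨c₁, h₁, c₂, h₂, rfl⟩
        exact ⟨c₂, h₂, c₁, h₁, Finset.union_comm _ _⟩
      · rintro ⟨c₂, h₂, c₁, h₁, rfl⟩
        exact ⟨c₁, h₁, c₂, h₂, Finset.union_comm _ _⟩
    exact Submodule.mem_sup_right ⟨hf e he,
      dual_mem_coordSubspace hdisj.symm (Set.union_comm E₁ E₂ ▸ hcover) h𝔅₂ h𝔅₁ hpl' hb₂ hb₁ he'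
        (hf e he) (Finset.union_comm b₁ b₂ ▸ hfi e he)⟩
end

section
/- Let 0 < r < n and let F be an r-dimensional subspace of ℂⁿ such that every r-element subset of {1,…,n} is a Plücker basis of F (i.e., the matroid of F is the uniform matroid, equivalently all Plücker coordinates of F are nonzero). If d = (d₁,…,d_n) ∈ (ℂˣ)ⁿ satisfies d·F = F, where d acts by coordinatewise scaling (d·x)_i = d_i x_i, then d₁ = d₂ = ⋯ = d_n. (Hence the diagonal torus H ⊂ PGL(n) acts freely on the open locus Fl°(r⃗,n) of flags with all nonzero Plücker coordinates.) -/
namespace IsPlueckerBasis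

variable {K ι : Type*} [Field K] {F : Submodule K (ι → K)} {l : Finset ι}

theorem eq_zero_of_forall_mem (h : IsPlueckerBasis F l) {x : ι → K} (hx : x ∈ F)
    (hl : ∀ i ∈ l, x i = 0) : x = 0 := by
  have h0 : (⟨x, hx⟩ : F) = 0 := h.injective <| by
    ext i
    simpa [LinearMap.funLeft] using hl i i.2
  exact congrArg Subtype.val h0

theorem exists_mem_forall_eq (h : IsPlueckerBasis F l) (y : ι → K) :
    ∃ x ∈ F, ∀ i ∈ l, x i = y i := by
  obtain ⟨x, hx⟩ := h.surjective fun i => y i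
  exact ⟨x, x.2, fun i hi => congrFun hx ⟨i, hi⟩⟩

/-- If `S ∪ {i}` and `S ∪ {j}` are both Plücker bases of `F`, any coordinatewise scaling
preserving `F` has the same `i`-th and `j`-th coefficients. -/
theorem scaling_eq [DecidableEq ι] {S : Finset ι} {i j : ι} (hiS : i ∉ S)
    (hi : IsPlueckerBasis F (insert i S)) (hj : IsPlueckerBasis F (insert j S))
    {d : ι → K} (hd : ∀ x ∈ F, d * x ∈ F) : d i = d j := by
  obtain ⟨x, hxF, hx⟩ := hi.exists_mem_forall_eq (Pi.single i 1)
  have hxi : x i = 1 := by simpa using hx i (Finset.mem_insert_self i S)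
  have hxS : ∀ k ∈ S, x k = 0 := fun k hk => by
    rw [hx k (Finset.mem_insert_of_mem hk), Pi.single_eq_of_ne (ne_of_mem_of_not_mem hk hiS)]
  have hxj : x j ≠ 0 := fun h0 => by
    have hx0 := hj.eq_zero_of_forall_mem hxF
      ((Finset.forall_mem_insert j S _).2 ⟨h0, hxS⟩)
    simp [hx0] at hxi
  have hz : d * x - d i • x = 0 :=
    hi.eq_zero_of_forall_mem (F.sub_mem (hd x hxF) (F.smul_mem (d i) hxF)) <|
      (Finset.forall_mem_insert i S _).2 ⟨by simp, fun k hk => by simp [hxS k hk]⟩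
  have hzj : d j * x j = d i * x j := by simpa [sub_eq_zero] using congrFun hz j
  exact (mul_right_cancel₀ hxj hzj).symm

end IsPlueckerBasis

/-- If `F ⊆ ℂⁿ` is an `r`-dimensional subspace with `0 < r < n` all of whose Plücker
coordinates are nonzero (every `r`-element subset is a Plücker basis), and
`d ∈ (ℂˣ)ⁿ` satisfies `d·F = F` for the coordinatewise scaling action, then all the
coordinates of `d` are equal. -/
theorem diagonal_stabilizer_trivial (n r : ℕ) (h0 : 0 < r) (hrn : r < n)
    (F : Submodule ℂ (Fin n → ℂ)) (hF : Module.finrank ℂ F = r)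
    (hunif : ∀ l : Finset (Fin n), l.card = r → IsPlueckerBasis F l)
    (d : Fin n → ℂˣ)
    (hd : F.map (LinearMap.pi fun i => ((d i : ℂ) • LinearMap.proj i :
        (Fin n → ℂ) →ₗ[ℂ] ℂ)) = F) :
    ∀ i j, d i = d j := by
  intro i j
  rcases eq_or_ne i j with rfl | hij
  · rfl
  obtain ⟨S, hS, hcard⟩ := Finset.exists_subset_card_eq (s := {i, j}ᶜ) (n := r - 1) <| by
    rw [Finset.card_compl, Finset.card_pair hij, Fintype.card_fin]
    omega
  have hiS : i ∉ S := fun h => by simpa using hS h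
  have hjS : j ∉ S := fun h => by simpa using hS h
  refine Units.ext (IsPlueckerBasis.scaling_eq (d := fun k => (d k : ℂ)) hiS
    (hunif _ ?_) (hunif _ ?_) fun x hx => ?_)
  · rw [Finset.card_insert_of_notMem hiS]
    omega
  · rw [Finset.card_insert_of_notMem hjS]
    omega
  · rw [← hd]
    exact Submodule.mem_map.2 ⟨x, hx, rfl⟩
end
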